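/- arXiv:2001.01783 — 4 statements merged into one kernel-verified Lean document; each statement's English description precedes it below -/
import Mathlib

section
/- Let a > 0 and 0 < σ < 2. Define K(x) = ∫_{ℝ³} e^{-a|y|}·(|y|^σ·|x−y|)^{-1} dy for x ∈ ℝ³ (with the convention |0−y| meaning |y|, i.e. K(0) = ∫ e^{-a|y|}|y|^{-1-σ} dy). Then K(0) = 4π·a^{σ-2}·Γ(2−σ); for every x ≠ 0 one has the strict inequality K(x) < 4π·a^{σ-2}·Γ(2−σ); and consequently sup_{x ∈ ℝ³} K(x) = 4π·a^{σ-2}·Γ(2−σ). In particular, the Kato norm of the Yukawa-type potential V(x) = c|x|^{-σ}e^{-a|x|}, defined as ‖V‖_K = sup_{x∈ℝ³} ∫_{ℝ³} |V(y)|/|x−y| dy, equals 4π·|c|·a^{σ-2}·Γ(2−σ). -/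
open MeasureTheory Real

section Rearrangement

variable {E : Type*} [NormedAddCommGroup E] [NormedSpace ℝ E] [FiniteDimensional ℝ E]
  [MeasurableSpace E] [BorelSpace E] {μ : Measure E} [μ.IsAddHaarMeasure] {F G : ℝ → ℝ}

/-- If the product of two nonnegative radially decreasing functions is integrable, then so is
the product of one with any translate of the other. -/
theorem integrable_radial_mul_comp_sub [Nontrivial E]
    (hF : AntitoneOn F (Set.Ioi 0)) (hG : AntitoneOn G (Set.Ioi 0))
    (hF0 : ∀ r, 0 < r → 0 ≤ F r) (hG0 : ∀ r, 0 < r → 0 ≤ G r)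
    (hFm : Measurable F) (hGm : Measurable G)
    (hint : Integrable (fun y : E => F ‖y‖ * G ‖y‖) μ) (x : E) :
    Integrable (fun y : E => F ‖y‖ * G ‖x - y‖) μ := by
  refine (hint.add (hint.comp_sub_left x)).mono' (by fun_prop) ?_
  filter_upwards [Measure.ae_ne μ 0, Measure.ae_ne μ x] with y hy0 hyx
  have h1 : 0 < ‖y‖ := norm_pos_iff.2 hy0
  have h2 : 0 < ‖x - y‖ := norm_pos_iff.2 (sub_ne_zero.2 hyx.symm)
  have hFy := hF0 _ h1
  have hGy := hG0 _ h1
  have hFxy := hF0 _ h2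
  have hGxy := hG0 _ h2
  rw [Real.norm_of_nonneg (mul_nonneg hFy hGxy), Pi.add_apply]
  rcases le_total ‖y‖ ‖x - y‖ with h | h
  · nlinarith [mul_le_mul_of_nonneg_left (hG h1 h2 h) hFy, mul_nonneg hFxy hGxy]
  · nlinarith [mul_le_mul_of_nonneg_right (hF h2 h1 h) hGxy, mul_nonneg hFy hGy]

/-- Translating one of two strictly radially decreasing functions strictly decreases the integral
of their product. -/
theorem integral_radial_mul_comp_sub_lt
    (hF : StrictAntiOn F (Set.Ioi 0)) (hG : StrictAntiOn G (Set.Ioi 0))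
    (hF0 : ∀ r, 0 < r → 0 ≤ F r) (hG0 : ∀ r, 0 < r → 0 ≤ G r)
    (hFm : Measurable F) (hGm : Measurable G)
    (hint : Integrable (fun y : E => F ‖y‖ * G ‖y‖) μ) {x : E} (hx : x ≠ 0) :
    ∫ y, F ‖y‖ * G ‖x - y‖ ∂μ < ∫ y, F ‖y‖ * G ‖y‖ ∂μ := by
  have : Nontrivial E := ⟨x, 0, hx⟩
  have hmix := integrable_radial_mul_comp_sub hF.antitoneOn hG.antitoneOn hF0 hG0 hFm hGm hint x
  have hmix' := hmix.comp_sub_left x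
  have hint' := hint.comp_sub_left x
  simp only [sub_sub_cancel] at hmix'
  have key : 0 < ∫ y, (F ‖y‖ - F ‖x - y‖) * (G ‖y‖ - G ‖x - y‖) ∂μ := by
    rw [integral_pos_iff_support_of_nonneg_ae]
    · let U : Set E := {y | ‖y‖ < ‖x - y‖} ∩ {0}ᶜ
      have hU : IsOpen U :=
        (isOpen_lt continuous_norm (by fun_prop)).inter isOpen_compl_singleton
      have hUne : U.Nonempty := by
        refine ⟨(1 / 4 : ℝ) • x, ?_, by simpa using hx⟩
        have h : x - (1 / 4 : ℝ) • x = (3 / 4 : ℝ) • x := by module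
        have hpos := norm_pos_iff.2 hx
        simp only [Set.mem_ofPred_eq, h, norm_smul, Real.norm_eq_abs]
        norm_num
        linarith
      refine (hU.measure_pos μ hUne).trans_le (measure_mono ?_)
      rintro y ⟨hy, hy0⟩
      have h1 : 0 < ‖y‖ := norm_pos_iff.2 hy0
      have h2 : 0 < ‖x - y‖ := h1.trans hy
      exact (mul_pos (sub_pos.2 (hF h1 h2 hy)) (sub_pos.2 (hG h1 h2 hy))).ne'
    · filter_upwards [Measure.ae_ne μ 0, Measure.ae_ne μ x] with y hy0 hyx
      have h1 : 0 < ‖y‖ := norm_pos_iff.2 hy0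
      have h2 : 0 < ‖x - y‖ := norm_pos_iff.2 (sub_ne_zero.2 hyx.symm)
      rcases le_total ‖y‖ ‖x - y‖ with h | h
      · exact mul_nonneg (sub_nonneg.2 (hF.antitoneOn h1 h2 h))
          (sub_nonneg.2 (hG.antitoneOn h1 h2 h))
      · exact mul_nonneg_of_nonpos_of_nonpos (sub_nonpos.2 (hF.antitoneOn h2 h1 h))
          (sub_nonpos.2 (hG.antitoneOn h2 h1 h))
    · convert! ((hint.add hint').sub hmix).sub hmix' using 2
      simp only [Pi.add_apply, Pi.sub_apply]
      ring
  have hexpand : ∫ y, (F ‖y‖ - F ‖x - y‖) * (G ‖y‖ - G ‖x - y‖) ∂μ =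
      ∫ y, F ‖y‖ * G ‖y‖ ∂μ + ∫ y, F ‖x - y‖ * G ‖x - y‖ ∂μ - ∫ y, F ‖y‖ * G ‖x - y‖ ∂μ
        - ∫ y, F ‖x - y‖ * G ‖y‖ ∂μ := by
    rw [← integral_add' hint hint', ← integral_sub' (hint.add hint') hmix,
      ← integral_sub' ((hint.add hint').sub hmix) hmix']
    congr 1 with y
    simp only [Pi.add_apply, Pi.sub_apply]
    ring
  have hself := integral_sub_left_eq_self (fun y => F ‖y‖ * G ‖y‖) μ x
  have hswap := integral_sub_left_eq_self (fun y => F ‖y‖ * G ‖x - y‖) μ x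
  simp only [sub_sub_cancel] at hswap
  rw [hexpand, hself, hswap] at key
  linarith

end Rearrangement

section Yukawa

variable {a σ : ℝ}

theorem strictAntiOn_exp_neg_mul_div_rpow (ha : 0 < a) (hσ : 0 < σ) :
    StrictAntiOn (fun r : ℝ => exp (-a * r) / r ^ σ) (Set.Ioi 0) := by
  intro r hr s _ hrs
  have hr' : 0 < r := hr
  have h : -a * s < -a * r := by nlinarith
  exact div_lt_div₀ (exp_lt_exp.2 h) (rpow_le_rpow hr'.le hrs.le hσ.le) (exp_pos _).le
    (rpow_pos_of_pos hr' σ)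

theorem yukawa_radial_density {r : ℝ} (hr : 0 < r) :
    r ^ 2 * (exp (-a * r) / r ^ σ * r⁻¹) = r ^ (1 - σ) * exp (-a * r) := by
  rw [rpow_sub hr, rpow_one]
  field_simp

theorem integrable_yukawa_radial (ha : 0 < a) (hσ2 : σ < 2) :
    Integrable (fun y : EuclideanSpace ℝ (Fin 3) => exp (-a * ‖y‖) / ‖y‖ ^ σ * ‖y‖⁻¹) := by
  rw [integrable_fun_norm_addHaar volume (f := fun r : ℝ => exp (-a * r) / r ^ σ * r⁻¹)]
  have h := integrableOn_rpow_mul_exp_neg_mul_rpow (s := 1 - σ) (by linarith) one_pos ha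
  simp only [rpow_one] at h
  refine h.congr_fun (fun r hr => ?_) measurableSet_Ioi
  simp only [finrank_euclideanSpace_fin, smul_eq_mul]
  exact (yukawa_radial_density hr).symm

theorem integral_yukawa_radial (ha : 0 < a) (hσ2 : σ < 2) :
    ∫ y : EuclideanSpace ℝ (Fin 3), exp (-a * ‖y‖) / ‖y‖ ^ σ * ‖y‖⁻¹ =
      4 * π * a ^ (σ - 2) * Gamma (2 - σ) := by
  rw [integral_fun_norm_addHaar volume (fun r : ℝ => exp (-a * r) / r ^ σ * r⁻¹)]
  have h : ∫ r in Set.Ioi (0 : ℝ), r ^ 2 * (exp (-a * r) / r ^ σ * r⁻¹) =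
      a ^ (σ - 2) * Gamma (2 - σ) := by
    rw [setIntegral_congr_fun (g := fun r => r ^ ((2 - σ) - 1) * exp (-(a * r)))
      measurableSet_Ioi, integral_rpow_mul_exp_neg_mul_Ioi (by linarith) ha,
      one_div, inv_rpow ha.le, ← rpow_neg ha.le, neg_sub]
    intro r hr
    simp only
    rw [yukawa_radial_density hr, ← neg_mul]
    ring_nf
  simp only [finrank_euclideanSpace_fin, smul_eq_mul, nsmul_eq_mul, Nat.add_one_sub_one] at h ⊢
  rw [h, Measure.real, EuclideanSpace.volume_ball_fin_three, ENNReal.toReal_mul,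
    ENNReal.toReal_ofReal (by positivity)]
  simp
  ring

end Yukawa

/-- the Kato norm of the Yukawa-type potential
`V(x) = c|x|^{-σ}e^{-a|x|}` equals `4π|c| a^{σ-2} Γ(2-σ)`. -/
theorem yukawa_kato_norm (a σ c : ℝ) (ha : 0 < a) (hσ0 : 0 < σ) (hσ2 : σ < 2)
    (K : EuclideanSpace ℝ (Fin 3) → ℝ)
    (hK : ∀ x, K x = ∫ y : EuclideanSpace ℝ (Fin 3),
      Real.exp (-a * ‖y‖) / (‖y‖ ^ σ * ‖x - y‖)) :
    K 0 = 4 * π * a ^ (σ - 2) * Real.Gamma (2 - σ) ∧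
    (∀ x : EuclideanSpace ℝ (Fin 3), x ≠ 0 →
      K x < 4 * π * a ^ (σ - 2) * Real.Gamma (2 - σ)) ∧
    (⨆ x : EuclideanSpace ℝ (Fin 3), K x) = 4 * π * a ^ (σ - 2) * Real.Gamma (2 - σ) ∧
    (⨆ x : EuclideanSpace ℝ (Fin 3), ∫ y : EuclideanSpace ℝ (Fin 3),
        |c * ‖y‖ ^ (-σ) * Real.exp (-a * ‖y‖)| / ‖x - y‖) =
      4 * π * |c| * a ^ (σ - 2) * Real.Gamma (2 - σ) := by
  have hK' (x) : K x = ∫ y : EuclideanSpace ℝ (Fin 3),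
      exp (-a * ‖y‖) / ‖y‖ ^ σ * ‖x - y‖⁻¹ := by
    simp only [hK, div_eq_mul_inv, mul_inv, mul_assoc]
  have h0 : K 0 = 4 * π * a ^ (σ - 2) * Gamma (2 - σ) := by
    simp only [hK', zero_sub, norm_neg, integral_yukawa_radial ha hσ2]
  have hlt (x : EuclideanSpace ℝ (Fin 3)) (hx : x ≠ 0) :
      K x < 4 * π * a ^ (σ - 2) * Gamma (2 - σ) := by
    rw [hK', ← integral_yukawa_radial ha hσ2]
    exact integral_radial_mul_comp_sub_lt (F := fun r => exp (-a * r) / r ^ σ)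
      (G := fun r => r⁻¹) (strictAntiOn_exp_neg_mul_div_rpow ha hσ0)
      (fun _ hr _ _ hrs => inv_strictAnti₀ hr hrs)
      (fun r hr => by positivity) (fun r hr => by positivity) (by fun_prop) (by fun_prop)
      (integrable_yukawa_radial ha hσ2) hx
  have hle (x) : K x ≤ 4 * π * a ^ (σ - 2) * Gamma (2 - σ) := by
    rcases eq_or_ne x 0 with rfl | hx
    exacts [h0.le, (hlt x hx).le]
  have hsup : (⨆ x, K x) = 4 * π * a ^ (σ - 2) * Gamma (2 - σ) :=
    le_antisymm (ciSup_le hle)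
      (h0.symm.le.trans (le_ciSup (f := K) ⟨_, Set.forall_mem_range.2 hle⟩ 0))
  refine ⟨h0, hlt, hsup, ?_⟩
  have hV (x : EuclideanSpace ℝ (Fin 3)) : ∫ y : EuclideanSpace ℝ (Fin 3),
      |c * ‖y‖ ^ (-σ) * exp (-a * ‖y‖)| / ‖x - y‖ = |c| * K x := by
    rw [hK', ← integral_const_mul]
    congr 1 with y
    rw [abs_mul, abs_mul, abs_exp, abs_of_nonneg (rpow_nonneg (norm_nonneg y) _),
      rpow_neg (norm_nonneg y)]
    ring
  simp only [hV]
  rw [← Real.mul_iSup_of_nonneg (abs_nonneg c), hsup]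
  ring
end

section
/- The function φ_R is radial and radially nonincreasing; for every x ∈ ℝ³ one has 0 ≤ φ_R(x) ≤ ψ_R(x) ≤ 1; for every x ≠ 0 one has ψ_R(x) ≤ 2R/|x|; and for every α > 0 and every x ∈ ℝ³ one has |φ_R(x) − φ_{1,R}(x)| ≤ 3η. -/
open MeasureTheory Real

section
variable {E : Type*} [NormedAddCommGroup E] [InnerProductSpace ℝ E]

/-- The linear part `L` of the affine reflection exchanging `x` and `y`, together with the change of
the squared norm under that reflection. -/
theorem exists_linearIsometryEquiv_swap {x y : E} (hxy : x ≠ y) :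
    ∃ L : E ≃ₗᵢ[ℝ] E, L x - L y = y - x ∧
      ∀ z, ‖L z + (x - L y)‖ ^ 2 - ‖z‖ ^ 2 =
        (‖x - z‖ ^ 2 - ‖y - z‖ ^ 2) * (‖x‖ ^ 2 - ‖y‖ ^ 2) / ‖x - y‖ ^ 2 := by
  have hu : ‖x - y‖ ^ 2 ≠ 0 := by
    have : ‖x - y‖ ≠ 0 := norm_ne_zero_iff.2 (sub_ne_zero.2 hxy)
    positivity
  let L : E ≃ₗᵢ[ℝ] E := (ℝ ∙ (x - y))ᗮ.reflection
  have hL : ∀ w, L w = w - (2 * (inner ℝ (x - y) w / ‖x - y‖ ^ 2)) • (x - y) := by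
    intro w
    simp only [L, Submodule.reflection_orthogonal_apply, Submodule.reflection_singleton_apply]
    simp [two_smul, two_mul, add_smul]
  refine ⟨L, ?_, fun z => ?_⟩
  · rw [← map_sub, hL, real_inner_self_eq_norm_sq, div_self hu]
    module
  · have h1 : L z + (x - L y) = z + ((‖x - z‖ ^ 2 - ‖y - z‖ ^ 2) / ‖x - y‖ ^ 2) • (x - y) := by
      have : (‖x - z‖ ^ 2 - ‖y - z‖ ^ 2) / ‖x - y‖ ^ 2
          = 1 + 2 * (inner ℝ (x - y) y / ‖x - y‖ ^ 2)
            - 2 * (inner ℝ (x - y) z / ‖x - y‖ ^ 2) := by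
        rw [div_eq_iff hu, sub_mul, add_mul, ← mul_div_assoc, ← mul_div_assoc,
          div_mul_cancel₀ _ hu, div_mul_cancel₀ _ hu]
        simp only [norm_sub_sq_real, inner_sub_left, real_inner_self_eq_norm_sq]
        ring
      rw [this, hL, hL]
      module
    rw [h1, norm_add_sq_real, norm_smul, mul_pow, Real.norm_eq_abs, sq_abs, inner_smul_right]
    field_simp
    simp only [norm_sub_sq_real, inner_sub_right, real_inner_comm]
    ring

variable [MeasurableSpace E] [BorelSpace E] [FiniteDimensional ℝ E]

/-- The convolution square of a radially nonincreasing function is radially nonincreasing. -/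
theorem integral_sub_mul_le_of_norm_le {f : E → ℝ} (hf : ∀ a b, ‖a‖ ≤ ‖b‖ → f b ≤ f a)
    (hint : ∀ x, Integrable fun z => f (x - z) * f z) {x y : E} (hxy : ‖x‖ ≤ ‖y‖) :
    ∫ z, f (y - z) * f z ≤ ∫ z, f (x - z) * f z := by
  rcases eq_or_ne x y with rfl | hne
  · rfl
  obtain ⟨L, hL, hnorm⟩ := exists_linearIsometryEquiv_swap hne
  let σ : E ≃ₜ E := L.toHomeomorph.trans (Homeomorph.addRight (x - L y))
  have hσ : ∀ z, σ z = L z + (x - L y) := fun z => rfl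
  have hσm : MeasurePreserving σ volume volume :=
    (measurePreserving_add_right volume (x - L y)).comp L.measurePreserving
  have hx : ∀ z, ‖x - σ z‖ = ‖y - z‖ := fun z => by
    rw [hσ, ← L.norm_map (y - z), map_sub]; congr 1; abel
  have hy : ∀ z, ‖y - σ z‖ = ‖x - z‖ := fun z => by
    rw [hσ, ← L.norm_map (x - z), map_sub]; congr 1
    rw [← sub_eq_zero] at hL ⊢
    rw [← neg_eq_zero, ← hL]; abel
  have heq : ∀ {a b}, ‖a‖ = ‖b‖ → f a = f b := fun h =>
    le_antisymm (hf _ _ h.ge) (hf _ _ h.le)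
  have hcomp : ∀ w, ∫ z, f (w - σ z) * f (σ z) = ∫ z, f (w - z) * f z := fun w =>
    hσm.integral_comp σ.measurableEmbedding fun z => f (w - z) * f z
  have hintc : ∀ w, Integrable fun z => f (w - σ z) * f (σ z) := fun w =>
    (hσm.integrable_comp_emb σ.measurableEmbedding).2 (hint w)
  have key : ∫ z, (f (y - z) * f z + f (y - σ z) * f (σ z)) ≤
      ∫ z, (f (x - z) * f z + f (x - σ z) * f (σ z)) := by
    refine integral_mono ((hint y).add (hintc y)) ((hint x).add (hintc x)) fun z => ?_
    simp only [heq (hx z), heq (hy z)]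
    have hu : 0 < ‖x - y‖ ^ 2 := by
      have : 0 < ‖x - y‖ := norm_pos_iff.2 (sub_ne_zero.2 hne)
      positivity
    have hxy2 : ‖x‖ ^ 2 - ‖y‖ ^ 2 ≤ 0 := sub_nonpos.2 (by gcongr)
    have hn := hnorm z
    rw [← hσ] at hn
    rcases le_total ‖x - z‖ ‖y - z‖ with h | h
    · have h2 : ‖x - z‖ ^ 2 - ‖y - z‖ ^ 2 ≤ 0 := sub_nonpos.2 (by gcongr)
      have h3 : ‖z‖ ≤ ‖σ z‖ := by
        refine le_of_sq_le_sq ?_ (norm_nonneg _)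
        have := div_nonneg (mul_nonneg_of_nonpos_of_nonpos h2 hxy2) hu.le
        linarith
      nlinarith [hf _ _ h, hf _ _ h3]
    · have h2 : 0 ≤ ‖x - z‖ ^ 2 - ‖y - z‖ ^ 2 := sub_nonneg.2 (by gcongr)
      have h3 : ‖σ z‖ ≤ ‖z‖ := by
        refine le_of_sq_le_sq ?_ (norm_nonneg _)
        have := div_nonpos_of_nonpos_of_nonneg (mul_nonpos_of_nonneg_of_nonpos h2 hxy2) hu.le
        linarith
      nlinarith [hf _ _ h, hf _ _ h3]
  rw [integral_add (hint y) (hintc y), integral_add (hint x) (hintc x), hcomp, hcomp] at key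
  linarith
end

/-- basic properties of the localization functions `φ_R`, `φ_{1,R}`, `ψ_R`. -/
theorem properties_of_phi_psi
    (η : ℝ) (hη : η ∈ Set.Ioo (0 : ℝ) 1)
    (χ : EuclideanSpace ℝ (Fin 3) → ℝ)
    (hχsmooth : ContDiff ℝ (⊤ : ℕ∞) χ)
    (hχradial : ∀ x y, ‖x‖ = ‖y‖ → χ x = χ y)
    (hχmono : ∀ x y, ‖x‖ ≤ ‖y‖ → χ y ≤ χ x)
    (hχ01 : ∀ x, χ x ∈ Set.Icc (0 : ℝ) 1)
    (hχone : ∀ x, ‖x‖ ≤ 1 - η → χ x = 1)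
    (hχzero : ∀ x, 1 < ‖x‖ → χ x = 0)
    (R : ℝ) (hR : 0 < R)
    (φ : EuclideanSpace ℝ (Fin 3) → ℝ)
    (hφ : ∀ x, φ x = ((4 * π / 3) * R ^ 3)⁻¹ *
      ∫ z : EuclideanSpace ℝ (Fin 3), χ (R⁻¹ • (x - z)) ^ 2 * χ (R⁻¹ • z) ^ 2)
    (φ₁ : ℝ → EuclideanSpace ℝ (Fin 3) → ℝ)
    (hφ₁ : ∀ (α : ℝ) x, φ₁ α x = ((4 * π / 3) * R ^ 3)⁻¹ *
      ∫ z : EuclideanSpace ℝ (Fin 3), χ (R⁻¹ • (x - z)) ^ 2 * χ (R⁻¹ • z) ^ (α + 2))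
    (ψ : EuclideanSpace ℝ (Fin 3) → ℝ)
    (hψ : ∀ x, x ≠ 0 → ψ x = ‖x‖⁻¹ *
      ∫ τ in (0 : ℝ)..‖x‖, φ (τ • (EuclideanSpace.single (0 : Fin 3) (1 : ℝ))))
    (hψ0 : ψ 0 = φ 0) :
    (∀ x y, ‖x‖ = ‖y‖ → φ x = φ y) ∧
    (∀ x y, ‖x‖ ≤ ‖y‖ → φ y ≤ φ x) ∧
    (∀ x, 0 ≤ φ x ∧ φ x ≤ ψ x ∧ ψ x ≤ 1) ∧
    (∀ x : EuclideanSpace ℝ (Fin 3), x ≠ 0 → ψ x ≤ 2 * R / ‖x‖) ∧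
    (∀ α : ℝ, 0 < α → ∀ x, |φ x - φ₁ α x| ≤ 3 * η) := by
  have hη0 : 0 < η := hη.1
  have hη1 : η < 1 := hη.2
  have hω : 0 < 4 * π / 3 * R ^ 3 := by positivity
  have hχc : Continuous χ := hχsmooth.continuous
  have hnorm : ∀ z : EuclideanSpace ℝ (Fin 3), ‖R⁻¹ • z‖ = ‖z‖ / R := fun z => by
    rw [norm_smul, Real.norm_of_nonneg (by positivity), div_eq_inv_mul]
  have hzero : ∀ z : EuclideanSpace ℝ (Fin 3), R < ‖z‖ → χ (R⁻¹ • z) = 0 := fun z hz =>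
    hχzero _ (by rwa [hnorm, one_lt_div hR])
  have hint : ∀ s : ℝ, 0 < s → ∀ x, Integrable fun z : EuclideanSpace ℝ (Fin 3) =>
      χ (R⁻¹ • (x - z)) ^ 2 * χ (R⁻¹ • z) ^ s := by
    intro s hs x
    refine Continuous.integrable_of_hasCompactSupport ?_ ?_
    · exact ((hχc.comp (by fun_prop)).pow 2).mul
        ((hχc.comp (by fun_prop)).rpow_const fun _ => Or.inr hs.le)
    · refine HasCompactSupport.intro (isCompact_closedBall 0 R) fun z hz => ?_
      rw [hzero z (by simpa using hz), Real.zero_rpow hs.ne', mul_zero]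
  have hint2 : ∀ x, Integrable fun z : EuclideanSpace ℝ (Fin 3) =>
      χ (R⁻¹ • (x - z)) ^ 2 * χ (R⁻¹ • z) ^ 2 := fun x => by
    simpa using hint 2 two_pos x
  have hsq : ∀ z, 0 ≤ χ z ^ 2 ∧ χ z ^ 2 ≤ 1 := fun z =>
    ⟨sq_nonneg _, pow_le_one₀ (hχ01 z).1 (hχ01 z).2⟩
  have hvol : ∀ r : ℝ, 0 ≤ r →
      volume.real (Metric.closedBall (0 : EuclideanSpace ℝ (Fin 3)) r) = 4 * π / 3 * r ^ 3 := by
    intro r hr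
    rw [measureReal_def, EuclideanSpace.volume_closedBall_fin_three, ENNReal.toReal_mul,
      ENNReal.toReal_pow, ENNReal.toReal_ofReal hr, ENNReal.toReal_ofReal (by positivity)]
    ring
  have hind : ∀ r : ℝ, Integrable
      ((Metric.closedBall (0 : EuclideanSpace ℝ (Fin 3)) r).indicator fun _ => (1 : ℝ)) :=
    fun r => (integrable_indicator_iff measurableSet_closedBall).2
      (integrableOn_const (isCompact_closedBall _ _).measure_ne_top)
  have hindint : ∀ r : ℝ, 0 ≤ r →
      ∫ z, (Metric.closedBall (0 : EuclideanSpace ℝ (Fin 3)) r).indicator (fun _ => (1 : ℝ)) z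
        = 4 * π / 3 * r ^ 3 := fun r hr => by
    rw [integral_indicator_const _ measurableSet_closedBall, hvol r hr, smul_eq_mul, mul_one]
  have hφmono : ∀ x y, ‖x‖ ≤ ‖y‖ → φ y ≤ φ x := by
    intro x y hxy
    rw [hφ, hφ]
    refine mul_le_mul_of_nonneg_left ?_ (by positivity)
    refine integral_sub_mul_le_of_norm_le (f := fun z => χ (R⁻¹ • z) ^ 2) (fun a b hab => ?_)
      hint2 hxy
    refine pow_le_pow_left₀ (hχ01 _).1 (hχmono _ _ ?_) 2
    rw [hnorm, hnorm]
    gcongr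
  have hφ0 : ∀ x, 0 ≤ φ x := fun x => by
    rw [hφ]
    exact mul_nonneg (by positivity)
      (integral_nonneg fun z => mul_nonneg (sq_nonneg _) (sq_nonneg _))
  have hφ1 : ∀ x, φ x ≤ 1 := fun x => by
    rw [hφ, inv_mul_le_iff₀ hω, mul_one, ← hindint R hR.le]
    refine integral_mono (hint2 x) (hind R) fun z => ?_
    by_cases hz : z ∈ Metric.closedBall (0 : EuclideanSpace ℝ (Fin 3)) R
    · simpa [Set.indicator_of_mem hz] using mul_le_one₀ (hsq _).2 (hsq _).1 (hsq _).2
    · simp [Set.indicator_of_notMem hz, hzero z (by simpa using hz)]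
  have hφfar : ∀ x, 2 * R < ‖x‖ → φ x = 0 := fun x hx => by
    rw [hφ]
    have : ∀ z, χ (R⁻¹ • (x - z)) ^ 2 * χ (R⁻¹ • z) ^ 2 = 0 := fun z => by
      rcases lt_or_ge R ‖z‖ with hz | hz
      · simp [hzero z hz]
      · have := norm_sub_norm_le x z
        simp [hzero (x - z) (by linarith)]
    simp [this]
  set e : EuclideanSpace ℝ (Fin 3) := EuclideanSpace.single 0 1 with he
  have hnt : ∀ τ : ℝ, 0 ≤ τ → ‖τ • e‖ = τ := fun τ hτ => by
    simp [he, norm_smul, abs_of_nonneg hτ]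
  have hii : ∀ a b : ℝ, 0 ≤ a → 0 ≤ b → IntervalIntegrable (fun τ => φ (τ • e)) volume a b := by
    intro a b ha hb
    refine AntitoneOn.intervalIntegrable fun s hs t ht hst => hφmono _ _ ?_
    have h0 : 0 ≤ s := (le_min ha hb).trans hs.1
    rwa [hnt s h0, hnt t (h0.trans hst)]
  have hle : ∀ t : ℝ, 0 ≤ t → ∫ τ in (0 : ℝ)..t, φ (τ • e) ≤ t := fun t ht => by
    simpa using intervalIntegral.integral_mono_on (g := fun _ => (1 : ℝ)) ht (hii 0 t le_rfl ht)
      (by simp) fun τ _ => hφ1 _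
  refine ⟨fun x y h => le_antisymm (hφmono _ _ h.ge) (hφmono _ _ h.le), hφmono,
    fun x => ⟨hφ0 x, ?_⟩, fun x hx => ?_, fun α hα x => ?_⟩
  · rcases eq_or_ne x 0 with rfl | hx
    · exact ⟨hψ0.ge, hψ0.trans_le (hφ1 0)⟩
    have hxp : 0 < ‖x‖ := norm_pos_iff.2 hx
    rw [hψ x hx, inv_mul_le_iff₀ hxp, le_inv_mul_iff₀ hxp, mul_one]
    refine ⟨?_, hle _ hxp.le⟩
    simpa using intervalIntegral.integral_mono_on (f := fun _ => φ x) hxp.le (by simp)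
      (hii 0 ‖x‖ le_rfl hxp.le) fun τ hτ => hφmono _ _ ((hnt τ hτ.1).trans_le hτ.2)
  · have hxp : 0 < ‖x‖ := norm_pos_iff.2 hx
    rw [hψ x hx, ← div_eq_inv_mul]
    gcongr
    rcases le_total ‖x‖ (2 * R) with h | h
    · exact (hle _ hxp.le).trans h
    have hR2 : 0 ≤ 2 * R := by positivity
    rw [← intervalIntegral.integral_add_adjacent_intervals (hii 0 (2 * R) le_rfl hR2)
      (hii (2 * R) ‖x‖ hR2 hxp.le)]
    have h0 : ∫ τ in (2 * R)..‖x‖, φ (τ • e) = 0 := by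
      refine intervalIntegral.integral_zero_ae (Filter.Eventually.of_forall fun τ hτ => ?_)
      rw [Set.uIoc_of_le h] at hτ
      exact hφfar _ (by rw [hnt τ (hR2.trans hτ.1.le)]; exact hτ.1)
    rw [h0, add_zero]
    exact hle _ hR2
  · have hpow : ∀ z, χ z ^ (α + 2) ≤ χ z ^ 2 := fun z => by
      rw [← Real.rpow_two]
      exact Real.rpow_le_rpow_of_exponent_ge_of_imp (hχ01 z).1 (hχ01 z).2 (by linarith)
        fun _ h => by linarith
    have hpow0 : ∀ z, 0 ≤ χ z ^ (α + 2) := fun z => Real.rpow_nonneg (hχ01 z).1 _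
    have hr : 0 ≤ R * (1 - η) := mul_nonneg hR.le (by linarith)
    have hrR : R * (1 - η) ≤ R := by nlinarith
    rw [hφ, hφ₁, ← mul_sub, ← integral_sub (hint2 x) (hint (α + 2) (by linarith) x),
      abs_of_nonneg, inv_mul_le_iff₀ hω]
    · calc _ ≤ ∫ z, ((Metric.closedBall (0 : EuclideanSpace ℝ (Fin 3)) R).indicator
              (fun _ => (1 : ℝ)) z -
            (Metric.closedBall (0 : EuclideanSpace ℝ (Fin 3)) (R * (1 - η))).indicator
              (fun _ => (1 : ℝ)) z) := by
            refine integral_mono ((hint2 x).sub (hint (α + 2) (by linarith) x))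
              ((hind R).sub (hind (R * (1 - η)))) fun z => ?_
            rcases le_or_gt ‖z‖ (R * (1 - η)) with h | h
            · have h1 : χ (R⁻¹ • z) = 1 :=
                hχone _ (by rw [hnorm, div_le_iff₀ hR]; linarith)
              simp [Set.indicator, h, h.trans hrR, h1]
            rcases le_or_gt ‖z‖ R with h' | h'
            · have h1 := mul_le_one₀ (hsq (R⁻¹ • (x - z))).2 (hsq (R⁻¹ • z)).1
                (hsq (R⁻¹ • z)).2
              have h2 := mul_nonneg (hsq (R⁻¹ • (x - z))).1 (hpow0 (R⁻¹ • z))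
              simp only [Set.indicator, mem_closedBall_zero_iff, h', h.not_ge, if_true, if_false]
              linarith
            · have hα2 : α + 2 ≠ 0 := by linarith
              simp [Set.indicator, h.not_ge, h'.not_ge, hzero z h', Real.zero_rpow hα2]
        _ = 4 * π / 3 * R ^ 3 * (1 - (1 - η) ^ 3) := by
            rw [integral_sub (hind R) (hind _), hindint R hR.le, hindint _ hr]
            ring
        _ ≤ 4 * π / 3 * R ^ 3 * (3 * η) := by
            gcongr
            nlinarith [mul_nonneg (sq_nonneg η) (by linarith : 0 ≤ 3 - η)]
    · refine mul_nonneg (by positivity) (integral_nonneg fun z => sub_nonneg.2 ?_)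
      exact mul_le_mul_of_nonneg_left (hpow _) (sq_nonneg _)
end

section
/- For every x ≠ 0 the function ψ_R is differentiable at x with gradient ∇ψ_R(x) = (φ_R(x) − ψ_R(x))·x/|x|², i.e. ∂_j ψ_R(x) = (x_j/|x|²)(φ_R(x) − ψ_R(x)) for j = 1,2,3. Moreover there exists a constant C > 0, depending only on χ, such that for every R > 0 and every x ∈ ℝ³ (x ≠ 0 where |x| appears in a denominator): |∇φ_R(x)| ≤ C/R, |ψ_R(x) − φ_R(x)| ≤ C·min{|x|/R, R/|x|}, and |∇ψ_R(x)| ≤ C·min{1/R, R/|x|²}. -/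
open MeasureTheory Real

/-- The running average of a Lipschitz function is close to the function. -/
lemma abs_average_sub_le_of_lipschitz {h : ℝ → ℝ} {K r : ℝ} (hK : 0 ≤ K)
    (hlip : ∀ s t, |h s - h t| ≤ K * |s - t|) (hcont : Continuous h) (hr : 0 < r) :
    |r⁻¹ * (∫ τ in (0 : ℝ)..r, h τ) - h r| ≤ K * r := by
  have hsub : r⁻¹ * (∫ τ in (0 : ℝ)..r, h τ) - h r = r⁻¹ * ∫ τ in (0 : ℝ)..r, (h τ - h r) := by
    rw [intervalIntegral.integral_sub (hcont.intervalIntegrable _ _) (by simp)]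
    simp only [intervalIntegral.integral_const, sub_zero, smul_eq_mul]
    field_simp
  have hbound : |∫ τ in (0 : ℝ)..r, (h τ - h r)| ≤ (K * r) * |r - 0| := by
    rw [← Real.norm_eq_abs]
    refine intervalIntegral.norm_integral_le_of_norm_le_const fun τ hτ => ?_
    rw [Set.uIoc_of_le hr.le] at hτ
    refine (hlip τ r).trans (mul_le_mul_of_nonneg_left ?_ hK)
    rw [abs_le]
    constructor <;> linarith [hτ.1, hτ.2]
  rw [hsub, abs_mul, abs_of_pos (inv_pos.2 hr)]
  rw [sub_zero, abs_of_pos hr] at hbound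
  calc r⁻¹ * |∫ τ in (0 : ℝ)..r, (h τ - h r)| ≤ r⁻¹ * (K * r * r) := by gcongr
    _ = K * r := by field_simp

/-- The running average of a Lipschitz function which vanishes on `[a, ∞)` decays like `1 / r`. -/
lemma abs_average_le_of_lipschitz_of_eq_zero {h : ℝ → ℝ} {K a r : ℝ} (hK : 0 ≤ K)
    (hlip : ∀ s t, |h s - h t| ≤ K * |s - t|) (hcont : Continuous h) (ha : 0 < a)
    (hzero : ∀ t, a ≤ t → h t = 0) (har : a ≤ r) :
    |r⁻¹ * ∫ τ in (0 : ℝ)..r, h τ| ≤ K * a ^ 2 / r := by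
  have hr : 0 < r := ha.trans_le har
  have htail : ∫ τ in a..r, h τ = 0 := by
    refine intervalIntegral.integral_zero_ae (Filter.Eventually.of_forall fun τ hτ => ?_)
    rw [Set.uIoc_of_le har] at hτ
    exact hzero τ hτ.1.le
  have hsplit : ∫ τ in (0 : ℝ)..r, h τ = ∫ τ in (0 : ℝ)..a, h τ := by
    rw [← intervalIntegral.integral_add_adjacent_intervals
      (hcont.intervalIntegrable 0 a) (hcont.intervalIntegrable a r), htail, add_zero]
  have hbound : |∫ τ in (0 : ℝ)..a, h τ| ≤ (K * a) * |a - 0| := by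
    rw [← Real.norm_eq_abs]
    refine intervalIntegral.norm_integral_le_of_norm_le_const fun τ hτ => ?_
    rw [Set.uIoc_of_le ha.le] at hτ
    have hτa := hlip τ a
    rw [hzero a le_rfl, sub_zero] at hτa
    refine hτa.trans (mul_le_mul_of_nonneg_left ?_ hK)
    rw [abs_le]
    constructor <;> linarith [hτ.1, hτ.2]
  rw [hsplit, abs_mul, abs_of_pos (inv_pos.2 hr)]
  rw [sub_zero, abs_of_pos ha] at hbound
  calc r⁻¹ * |∫ τ in (0 : ℝ)..a, h τ| ≤ r⁻¹ * (K * a * a) := by gcongr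
    _ = K * a ^ 2 / r := by field_simp

/-- Difference between a function and its running average, for a `K / R`-Lipschitz function
supported in `(-∞, 3R]`. -/
lemma abs_average_sub_le_min {h : ℝ → ℝ} {K R r : ℝ} (hK : 0 ≤ K) (hR : 0 < R)
    (hlip : ∀ s t, |h s - h t| ≤ K / R * |s - t|) (hcont : Continuous h)
    (hzero : ∀ t, 3 * R ≤ t → h t = 0) (hr : 0 < r) :
    |r⁻¹ * (∫ τ in (0 : ℝ)..r, h τ) - h r| ≤ (9 * K) * min (r / R) (R / r) := by
  have hKR : 0 ≤ K / R := by positivity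
  have hnear := abs_average_sub_le_of_lipschitz hKR hlip hcont hr
  rw [mul_min_of_nonneg _ _ (by positivity : (0 : ℝ) ≤ 9 * K), le_min_iff]
  refine ⟨hnear.trans ?_, ?_⟩
  · have : K / R * r = K * (r / R) := by ring
    have : 0 ≤ K * (r / R) := by positivity
    linarith
  · rcases le_total (3 * R) r with hle | hle
    · have hfar := abs_average_le_of_lipschitz_of_eq_zero hKR hlip hcont (by positivity) hzero hle
      rw [hzero r hle, sub_zero]
      refine hfar.trans (le_of_eq ?_)
      field_simp
      ring
    · refine hnear.trans ?_
      rw [div_mul_eq_mul_div, mul_div_assoc', div_le_div_iff₀ hR hr]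
      have : r * r ≤ (3 * R) * (3 * R) := mul_self_le_mul_self hr.le hle
      nlinarith [mul_le_mul_of_nonneg_left this hK]

/-- Derivative of the running average. -/
lemma hasDerivAt_average {h : ℝ → ℝ} (hcont : Continuous h) {r : ℝ} (hr : r ≠ 0) :
    HasDerivAt (fun s => s⁻¹ * ∫ τ in (0 : ℝ)..s, h τ)
      ((h r - r⁻¹ * ∫ τ in (0 : ℝ)..r, h τ) / r) r := by
  have hint := intervalIntegral.integral_hasDerivAt_right (hcont.intervalIntegrable 0 r)
    (hcont.stronglyMeasurableAtFilter _ _) hcont.continuousAt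
  refine ((hasDerivAt_inv hr).mul hint).congr_deriv ?_
  field_simp
  ring

/-- Gradient of a radial function. -/
lemma HasDerivAt.hasGradientAt_comp_norm {E : Type*} [NormedAddCommGroup E]
    [InnerProductSpace ℝ E] [CompleteSpace E] {G : ℝ → ℝ} {G' : ℝ} {x : E} (hx : x ≠ 0)
    (hG : HasDerivAt G G' ‖x‖) :
    HasGradientAt (fun y => G ‖y‖) ((G' / ‖x‖) • x) x := by
  have hnx : ‖x‖ ≠ 0 := norm_ne_zero_iff.2 hx
  have hsq : HasFDerivAt (fun y : E => ‖y‖ ^ 2) (2 • innerSL ℝ x) x :=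
    (hasStrictFDerivAt_norm_sq x).hasFDerivAt
  have hsqrt := hsq.sqrt (pow_ne_zero 2 hnx)
  simp only [Real.sqrt_sq (norm_nonneg _)] at hsqrt
  have hcomp := hG.comp_hasFDerivAt x hsqrt
  rw [hasGradientAt_iff_hasFDerivAt]
  refine hcomp.congr_fderiv ?_
  ext y
  simp
  field_simp

/-- A convolution of two radial functions is radial. -/
lemma integral_comp_sub_mul_eq_of_norm_eq {E : Type*} [NormedAddCommGroup E]
    [InnerProductSpace ℝ E] [FiniteDimensional ℝ E] [MeasurableSpace E] [BorelSpace E]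
    {f g : E → ℝ} (hf : ∀ x y, ‖x‖ = ‖y‖ → f x = f y) (hg : ∀ x y, ‖x‖ = ‖y‖ → g x = g y)
    {x y : E} (hxy : ‖x‖ = ‖y‖) :
    ∫ z, f (x - z) * g z = ∫ z, f (y - z) * g z := by
  set A := (ℝ ∙ (x - y))ᗮ.reflection
  have hAx : A x = y := Submodule.reflection_sub hxy
  rw [← A.measurePreserving.integral_comp A.toHomeomorph.measurableEmbedding
    (fun z => f (y - z) * g z)]
  congr 1 with z
  rw [← hAx, ← map_sub, hf (A (x - z)) (x - z) (A.norm_map _), hg (A z) z (A.norm_map _)]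

/-- Lipschitz bound for a rescaled convolution. -/
lemma abs_integral_comp_smul_sub_le {E : Type*} [NormedAddCommGroup E]
    [InnerProductSpace ℝ E] [FiniteDimensional ℝ E] [MeasurableSpace E] [BorelSpace E]
    {g : E → ℝ} {L : ℝ} (hlip : ∀ x y, |g x - g y| ≤ L * ‖x - y‖) (hcont : Continuous g)
    (hsupp : HasCompactSupport g) (hnonneg : ∀ x, 0 ≤ g x) {R : ℝ} (hR : 0 < R) (x y : E) :
    |(∫ z, g (R⁻¹ • (x - z)) * g (R⁻¹ • z)) - ∫ z, g (R⁻¹ • (y - z)) * g (R⁻¹ • z)| ≤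
      L / R * ‖x - y‖ * (R ^ Module.finrank ℝ E * ∫ z, g z) := by
  have hsupp' : HasCompactSupport fun z => g (R⁻¹ • z) :=
    hsupp.comp_smul (inv_ne_zero hR.ne')
  have hint : ∀ w : E, Integrable fun z => g (R⁻¹ • (w - z)) * g (R⁻¹ • z) := fun w =>
    Continuous.integrable_of_hasCompactSupport (by fun_prop) hsupp'.mul_left
  have hint' : Integrable fun z => g (R⁻¹ • z) :=
    Continuous.integrable_of_hasCompactSupport (by fun_prop) hsupp'
  rw [← integral_sub (hint x) (hint y)]
  have hscale : ∫ z, g (R⁻¹ • z) = R ^ Module.finrank ℝ E * ∫ z, g z := by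
    rw [Measure.integral_comp_inv_smul, abs_of_pos (by positivity), smul_eq_mul]
  rw [← hscale, ← integral_const_mul]
  rw [← Real.norm_eq_abs]
  refine norm_integral_le_of_norm_le (hint'.const_mul _) (Filter.Eventually.of_forall fun z => ?_)
  rw [Real.norm_eq_abs, ← sub_mul, abs_mul, abs_of_nonneg (hnonneg _)]
  refine mul_le_mul_of_nonneg_right ((hlip _ _).trans (le_of_eq ?_)) (hnonneg _)
  rw [← smul_sub, sub_sub_sub_cancel_right, norm_smul, norm_inv, Real.norm_of_nonneg hR.le]
  ring

/-- gradient formula for `ψ_R` and uniform bounds depending only on `χ`. -/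
theorem gradient_psi_and_bounds
    (η : ℝ) (hη : η ∈ Set.Ioo (0 : ℝ) 1)
    (χ : EuclideanSpace ℝ (Fin 3) → ℝ)
    (hχsmooth : ContDiff ℝ (⊤ : ℕ∞) χ)
    (hχradial : ∀ x y, ‖x‖ = ‖y‖ → χ x = χ y)
    (hχmono : ∀ x y, ‖x‖ ≤ ‖y‖ → χ y ≤ χ x)
    (hχ01 : ∀ x, χ x ∈ Set.Icc (0 : ℝ) 1)
    (hχone : ∀ x, ‖x‖ ≤ 1 - η → χ x = 1)
    (hχzero : ∀ x, 1 < ‖x‖ → χ x = 0)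
    (φ : ℝ → EuclideanSpace ℝ (Fin 3) → ℝ)
    (hφ : ∀ R : ℝ, 0 < R → ∀ x, φ R x = ((4 * π / 3) * R ^ 3)⁻¹ *
      ∫ z : EuclideanSpace ℝ (Fin 3), χ (R⁻¹ • (x - z)) ^ 2 * χ (R⁻¹ • z) ^ 2)
    (ψ : ℝ → EuclideanSpace ℝ (Fin 3) → ℝ)
    (hψ : ∀ R : ℝ, 0 < R → ∀ x, x ≠ 0 → ψ R x = ‖x‖⁻¹ *
      ∫ τ in (0 : ℝ)..‖x‖, φ R (τ • (EuclideanSpace.single (0 : Fin 3) (1 : ℝ))))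
    (hψ0 : ∀ R : ℝ, 0 < R → ψ R 0 = φ R 0) :
    (∀ R : ℝ, 0 < R → ∀ x : EuclideanSpace ℝ (Fin 3), x ≠ 0 →
      HasGradientAt (ψ R) (((φ R x - ψ R x) / ‖x‖ ^ 2) • x) x) ∧
    ∃ C : ℝ, 0 < C ∧ ∀ R : ℝ, 0 < R →
      (∀ x, ‖gradient (φ R) x‖ ≤ C / R) ∧
      (∀ x : EuclideanSpace ℝ (Fin 3), x ≠ 0 →
        |ψ R x - φ R x| ≤ C * min (‖x‖ / R) (R / ‖x‖) ∧
        ‖gradient (ψ R) x‖ ≤ C * min (1 / R) (R / ‖x‖ ^ 2)) := by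
  set e : EuclideanSpace ℝ (Fin 3) := EuclideanSpace.single (0 : Fin 3) (1 : ℝ) with he
  have hne : ‖e‖ = 1 := by simp [he]
  have hnsmul : ∀ t : ℝ, ‖t • e‖ = |t| := fun t => by rw [norm_smul, hne, mul_one, norm_eq_abs]
  set g : EuclideanSpace ℝ (Fin 3) → ℝ := fun x => χ x ^ 2 with hg
  have hgsmooth : ContDiff ℝ 1 g := (hχsmooth.of_le (by exact_mod_cast le_top)).pow 2
  have hgzero : ∀ x, 1 < ‖x‖ → g x = 0 := fun x hx => by simp [hg, hχzero x hx]
  have hgsupp : HasCompactSupport g := by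
    refine HasCompactSupport.intro (isCompact_closedBall (0 : EuclideanSpace ℝ (Fin 3)) 1)
      fun x hx => hgzero x ?_
    simpa using hx
  obtain ⟨L, hL⟩ := hgsmooth.lipschitzWith_of_hasCompactSupport hgsupp one_ne_zero
  have hglip : ∀ x y, |g x - g y| ≤ L * ‖x - y‖ := fun x y => by
    simpa [Real.dist_eq, dist_eq_norm] using hL.dist_le_mul x y
  have hgnonneg : ∀ x, 0 ≤ g x := fun x => sq_nonneg _
  set K : ℝ := (4 * π / 3)⁻¹ * (L * ∫ z, g z) with hK
  have hKnonneg : 0 ≤ K := by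
    have := integral_nonneg (μ := volume) (f := g) hgnonneg
    positivity
  have hφlip : ∀ R, 0 < R → ∀ x y, |φ R x - φ R y| ≤ K / R * ‖x - y‖ := by
    intro R hR x y
    rw [hφ R hR, hφ R hR, ← mul_sub, abs_mul, abs_of_nonneg (by positivity)]
    have := abs_integral_comp_smul_sub_le hglip hgsmooth.continuous hgsupp hgnonneg hR x y
    rw [finrank_euclideanSpace, Fintype.card_fin] at this
    refine (mul_le_mul_of_nonneg_left this (by positivity)).trans (le_of_eq ?_)
    rw [hK]
    field_simp
  have hφlipschitz : ∀ R, 0 < R → LipschitzWith (K / R).toNNReal (φ R) := fun R hR =>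
    LipschitzWith.of_dist_le_mul fun x y => by
      rw [Real.dist_eq, dist_eq_norm, Real.coe_toNNReal _ (by positivity)]
      exact hφlip R hR x y
  have hφradial : ∀ R, 0 < R → ∀ x y, ‖x‖ = ‖y‖ → φ R x = φ R y := by
    intro R hR x y hxy
    rw [hφ R hR, hφ R hR]
    congr 1
    have hscale : ∀ x y : EuclideanSpace ℝ (Fin 3), ‖x‖ = ‖y‖ → g (R⁻¹ • x) = g (R⁻¹ • y) :=
      fun x y h => by simp only [hg, hχradial _ _ (by rw [norm_smul, norm_smul, h] :
        ‖R⁻¹ • x‖ = ‖R⁻¹ • y‖)]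
    exact integral_comp_sub_mul_eq_of_norm_eq hscale hscale hxy
  have hφnorm : ∀ R, 0 < R → ∀ x, φ R (‖x‖ • e) = φ R x := fun R hR x =>
    hφradial R hR _ _ (by rw [hnsmul, abs_norm])
  have hφzero : ∀ R, 0 < R → ∀ x, 3 * R ≤ ‖x‖ → φ R x = 0 := by
    intro R hR x hx
    rw [hφ R hR]
    have hvanish : ∀ z, χ (R⁻¹ • (x - z)) ^ 2 * χ (R⁻¹ • z) ^ 2 = 0 := by
      intro z
      have hlarge : ∀ w : EuclideanSpace ℝ (Fin 3), R < ‖w‖ → χ (R⁻¹ • w) = 0 := fun w hw =>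
        hχzero _ (by
          rw [norm_smul, norm_inv, Real.norm_of_nonneg hR.le, inv_mul_eq_div, one_lt_div hR]
          exact hw)
      rcases lt_or_ge R ‖z‖ with hz | hz
      · rw [hlarge z hz]; ring
      · rw [hlarge (x - z) (by linarith [norm_sub_norm_le x z])]; ring
    simp [hvanish]
  have hcont : ∀ R, 0 < R → Continuous fun t : ℝ => φ R (t • e) := fun R hR =>
    (hφlipschitz R hR).continuous.comp (by fun_prop)
  have hgrad : ∀ R : ℝ, 0 < R → ∀ x : EuclideanSpace ℝ (Fin 3), x ≠ 0 →
      HasGradientAt (ψ R) (((φ R x - ψ R x) / ‖x‖ ^ 2) • x) x := by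
    intro R hR x hx
    have hG := (hasDerivAt_average (hcont R hR) (norm_ne_zero_iff.2 hx)).hasGradientAt_comp_norm hx
    rw [hφnorm R hR, ← hψ R hR x hx, div_div, ← sq] at hG
    refine HasGradientAt.congr_of_eventuallyEq hG ?_
    filter_upwards [isOpen_ne.mem_nhds hx] with y hy using hψ R hR y hy
  have hdiff : ∀ R : ℝ, 0 < R → ∀ x : EuclideanSpace ℝ (Fin 3), x ≠ 0 →
      |ψ R x - φ R x| ≤ (9 * K + 1) * min (‖x‖ / R) (R / ‖x‖) := by
    intro R hR x hx
    have hnx : 0 < ‖x‖ := norm_pos_iff.2 hx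
    have h := abs_average_sub_le_min (h := fun t => φ R (t • e)) hKnonneg hR
      (fun s t => by
        simpa only [← sub_smul, hnsmul] using hφlip R hR (s • e) (t • e))
      (hcont R hR)
      (fun t ht => hφzero R hR _ (by rw [hnsmul]; exact ht.trans (le_abs_self t))) hnx
    rw [hφnorm R hR, ← hψ R hR x hx] at h
    exact h.trans (mul_le_mul_of_nonneg_right (by linarith) (by positivity))
  refine ⟨hgrad, 9 * K + 1, by positivity, fun R hR => ⟨fun x => ?_, fun x hx =>
    ⟨hdiff R hR x hx, ?_⟩⟩⟩
  · rw [gradient, LinearIsometryEquiv.norm_map]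
    refine (norm_fderiv_le_of_lipschitz ℝ (hφlipschitz R hR)).trans ?_
    rw [Real.coe_toNNReal _ (by positivity)]
    gcongr
    linarith
  · have hnx : 0 < ‖x‖ := norm_pos_iff.2 hx
    rw [(hgrad R hR x hx).gradient, norm_smul, norm_div, norm_pow, norm_norm, norm_eq_abs,
      abs_sub_comm]
    calc |ψ R x - φ R x| / ‖x‖ ^ 2 * ‖x‖ = |ψ R x - φ R x| / ‖x‖ := by field_simp
      _ ≤ (9 * K + 1) * min (‖x‖ / R) (R / ‖x‖) / ‖x‖ := by gcongr; exact hdiff R hR x hx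
      _ = (9 * K + 1) * min (1 / R) (R / ‖x‖ ^ 2) := by
        rw [mul_div_assoc, ← min_div_div_right hnx.le]
        congr 2 <;> field_simp
end

section
/- Let 0 < α < 4 and let Q : ℝ³ → ℝ be a smooth positive function solving the elliptic equation −ΔQ + Q = Q^{α+1} on ℝ³, and suppose there exist constants C, c > 0 such that |Q(x)| + |∇Q(x)| ≤ C·e^{-c|x|} for all x. Then the Pohozaev identities hold: ‖Q‖_{L²}² = ((4−α)/(3α))·‖∇Q‖_{L²}² and ‖Q‖_{L²}² = ((4−α)/(2(α+2)))·‖Q‖_{L^{α+2}}^{α+2}. Consequently, the free energy E₀(Q) := (1/2)‖∇Q‖_{L²}² − (1/(α+2))‖Q‖_{L^{α+2}}^{α+2} satisfies E₀(Q) = ((3α−4)/(6α))·‖∇Q‖_{L²}² = ((3α−4)/(4(α+2)))·‖Q‖_{L^{α+2}}^{α+2}. -/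
open MeasureTheory Real

/-- Spatial partial derivative in the `j`-th coordinate direction on ℝ³. -/
noncomputable def pd {F : Type*} [NormedAddCommGroup F] [NormedSpace ℝ F]
    (j : Fin 3) (g : EuclideanSpace ℝ (Fin 3) → F) (x : EuclideanSpace ℝ (Fin 3)) : F :=
  fderiv ℝ g x (EuclideanSpace.single j 1)

local notation "E₃" => EuclideanSpace ℝ (Fin 3)

lemma Continuous.integrable_of_abs_le_one_add_norm_mul_exp {f : E₃ → ℝ} (hf : Continuous f)
    {K c : ℝ} (hc : 0 < c) (hK : 0 ≤ K)
    (hfb : ∀ x, |f x| ≤ K * ((1 + ‖x‖) * exp (-c * ‖x‖))) : Integrable f := by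
  have h4 : Integrable (fun x : E₃ => (1 + ‖x‖) ^ (-4 : ℝ)) :=
    integrable_one_add_norm (by simp; norm_num)
  refine (h4.const_mul (K * (exp c * (120 / c ^ 5)))).mono' hf.aestronglyMeasurable
    (.of_forall fun x => (hfb x).trans ?_)
  rw [mul_assoc]
  refine mul_le_mul_of_nonneg_left ?_ hK
  have ht : 0 < 1 + ‖x‖ := by positivity
  have h := Real.pow_div_factorial_le_exp (c * (1 + ‖x‖)) (by positivity) 5
  have h1 : exp (-c * ‖x‖) = exp c * (exp (c * (1 + ‖x‖)))⁻¹ := by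
    rw [← Real.exp_neg, ← Real.exp_add]; congr 1; ring
  have h2 : (1 + ‖x‖) ^ (-4 : ℝ) = ((1 + ‖x‖) ^ 4)⁻¹ := by
    rw [Real.rpow_neg ht.le]; norm_cast
  have h3 : (exp (c * (1 + ‖x‖)))⁻¹ ≤ ((c * (1 + ‖x‖)) ^ 5 / (Nat.factorial 5 : ℕ))⁻¹ :=
    inv_anti₀ (by positivity) h
  rw [h1, h2]
  calc (1 + ‖x‖) * (exp c * (exp (c * (1 + ‖x‖)))⁻¹)
      ≤ (1 + ‖x‖) * (exp c * ((c * (1 + ‖x‖)) ^ 5 / (Nat.factorial 5 : ℕ))⁻¹) := by gcongr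
    _ = exp c * (120 / c ^ 5) * ((1 + ‖x‖) ^ 4)⁻¹ := by
        rw [show (Nat.factorial 5 : ℕ) = 120 from rfl]; field_simp; norm_num

/-- The divergence of an integrable `C¹` vector field has integral zero as soon as it is
integrable. -/
lemma integral_sum_pd_eq_zero (F : Fin 3 → E₃ → ℝ) (hF : ∀ j, ContDiff ℝ 1 (F j))
    (hFi : ∀ j, Integrable (F j)) (hD : Integrable (fun x => ∑ j, pd j (F j) x)) :
    ∫ x, ∑ j, pd j (F j) x = 0 := by
  let b : ContDiffBump (0 : E₃) := ⟨1, 2, one_pos, one_lt_two⟩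
  have hb : ContDiff ℝ 1 b := b.contDiff
  have hbs : HasCompactSupport b := b.hasCompactSupport
  let r : ℕ → ℝ := fun n => ((n : ℝ) + 1)⁻¹
  have hr : Filter.Tendsto r Filter.atTop (nhds 0) := by
    simpa [r, one_div] using tendsto_one_div_add_atTop_nhds_zero_nat (𝕜 := ℝ)
  have hrne : ∀ n, r n ≠ 0 := fun n => by positivity
  let χ : ℕ → E₃ → ℝ := fun n x => b (r n • x)
  have hχ : ∀ n, ContDiff ℝ 1 (χ n) := fun n => hb.comp (contDiff_const_smul (r n))
  have hχs : ∀ n, HasCompactSupport (χ n) := fun n =>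
    hbs.comp_homeomorph (Homeomorph.smulOfNeZero (r n) (hrne n))
  have hdχ : ∀ n x v, fderiv ℝ (χ n) x v = r n * fderiv ℝ b (r n • x) v := by
    intro n x v
    have h := ((hb.differentiable one_ne_zero (r n • x)).hasFDerivAt).comp x
      ((hasFDerivAt_id x).const_smul (r n))
    have h' := h.fderiv
    change fderiv ℝ (χ n) x = _ at h'
    rw [h']; simp
  obtain ⟨M, hM⟩ : ∃ M, ∀ x, ‖fderiv ℝ b x‖ ≤ M :=
    (hbs.fderiv ℝ).exists_bound_of_continuous (hb.continuous_fderiv one_ne_zero)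
  have hcont : ∀ j, Continuous (pd j (F j)) := fun j =>
    ((hF j).continuous_fderiv one_ne_zero).clm_apply continuous_const
  have hparts : ∀ n j, ∫ x, χ n x * pd j (F j) x =
      -∫ x, fderiv ℝ (χ n) x (EuclideanSpace.single j 1) * F j x := by
    intro n j
    have hdc : Continuous (fun x => fderiv ℝ (χ n) x (EuclideanSpace.single j 1)) :=
      ((hχ n).continuous_fderiv one_ne_zero).clm_apply continuous_const
    have hds : HasCompactSupport (fun x => fderiv ℝ (χ n) x (EuclideanSpace.single j 1)) :=
      (hχs n).fderiv_apply ℝ _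
    exact integral_mul_fderiv_eq_neg_fderiv_mul_of_integrable
      ((hdc.mul (hF j).continuous).integrable_of_hasCompactSupport hds.mul_right)
      (((hχ n).continuous.mul (hcont j)).integrable_of_hasCompactSupport (hχs n).mul_right)
      (((hχ n).continuous.mul (hF j).continuous).integrable_of_hasCompactSupport
        (hχs n).mul_right)
      (fun x _ => (hχ n).differentiable one_ne_zero x)
      (fun x _ => (hF j).differentiable one_ne_zero x)
  have hsum : ∀ n, ∫ x, χ n x * ∑ j, pd j (F j) x =
      -∑ j, ∫ x, fderiv ℝ (χ n) x (EuclideanSpace.single j 1) * F j x := by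
    intro n
    simp_rw [Finset.mul_sum]
    have hi : ∀ j, Integrable (fun x => χ n x * pd j (F j) x) := fun j =>
      ((hχ n).continuous.mul (hcont j)).integrable_of_hasCompactSupport (hχs n).mul_right
    rw [integral_finsetSum _ fun j _ => hi j]
    simp_rw [hparts, Finset.sum_neg_distrib]
  have hlim : Filter.Tendsto (fun n => ∫ x, χ n x * ∑ j, pd j (F j) x) Filter.atTop
      (nhds (∫ x, ∑ j, pd j (F j) x)) := by
    refine tendsto_integral_of_dominated_convergence (fun x => ‖∑ j, pd j (F j) x‖)
      (fun n => ((hχ n).continuous.mul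
        (continuous_finsetSum _ fun j _ => hcont j)).aestronglyMeasurable)
      hD.norm (fun n => .of_forall fun x => ?_) (.of_forall fun x => ?_)
    · rw [norm_mul]
      refine mul_le_of_le_one_left (norm_nonneg _) ?_
      rw [Real.norm_of_nonneg b.nonneg]
      exact b.le_one
    · have h1 : Filter.Tendsto (fun n => χ n x) Filter.atTop (nhds 1) := by
        have h2 : Filter.Tendsto (fun n => r n • x) Filter.atTop (nhds 0) := by
          simpa using hr.smul_const x
        have h3 := (hb.continuous.tendsto 0).comp h2
        rwa [b.one_of_mem_closedBall (by simp [b])] at h3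
      simpa using h1.mul_const (∑ j, pd j (F j) x)
  have hlim0 : ∀ j, Filter.Tendsto
      (fun n => ∫ x, fderiv ℝ (χ n) x (EuclideanSpace.single j 1) * F j x) Filter.atTop
      (nhds 0) := by
    intro j
    have hbd : ∀ n x, ‖fderiv ℝ (χ n) x (EuclideanSpace.single j 1) * F j x‖ ≤
        |r n| * (M * ‖F j x‖) := by
      intro n x
      rw [hdχ, norm_mul, norm_mul, mul_assoc, Real.norm_eq_abs (r n)]
      gcongr
      refine ((fderiv ℝ b (r n • x)).le_opNorm _).trans ?_
      simpa using hM (r n • x)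
    refine squeeze_zero_norm (a := fun n => |r n| * ∫ x, M * ‖F j x‖) (fun n => ?_) ?_
    · rw [← integral_const_mul]
      exact norm_integral_le_of_norm_le (((hFi j).norm.const_mul M).const_mul _)
        (.of_forall (hbd n))
    · simpa using hr.abs.mul_const (∫ x, M * ‖F j x‖)
  have h0 : Filter.Tendsto (fun n => ∫ x, χ n x * ∑ j, pd j (F j) x) Filter.atTop
      (nhds 0) := by
    simp_rw [hsum]
    simpa using (tendsto_finsetSum Finset.univ fun j _ => hlim0 j).neg
  exact tendsto_nhds_unique hlim h0

section PartialDerivatives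

variable {f g : E₃ → ℝ} {x : E₃} (j : Fin 3)

lemma pd_add (hf : DifferentiableAt ℝ f x) (hg : DifferentiableAt ℝ g x) :
    pd j (fun y => f y + g y) x = pd j f x + pd j g x := by
  simp [pd, fderiv_fun_add hf hg]

lemma pd_sub (hf : DifferentiableAt ℝ f x) (hg : DifferentiableAt ℝ g x) :
    pd j (fun y => f y - g y) x = pd j f x - pd j g x := by
  simp [pd, fderiv_fun_sub hf hg]

lemma pd_mul (hf : DifferentiableAt ℝ f x) (hg : DifferentiableAt ℝ g x) :
    pd j (fun y => f y * g y) x = f x * pd j g x + pd j f x * g x := by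
  simp [pd, fderiv_fun_mul hf hg, mul_comm]

lemma pd_const_mul (a : ℝ) (hf : DifferentiableAt ℝ f x) :
    pd j (fun y => a * f y) x = a * pd j f x := by
  simp [pd, fderiv_const_mul hf]

lemma pd_sq (hf : DifferentiableAt ℝ f x) :
    pd j (fun y => f y ^ 2) x = 2 * f x * pd j f x := by
  simp_rw [pow_two, pd_mul j hf hf]; ring

lemma pd_rpow_const (p : ℝ) (hf : DifferentiableAt ℝ f x) (hx : f x ≠ 0) :
    pd j (fun y => f y ^ p) x = p * f x ^ (p - 1) * pd j f x := by
  simp [pd, (hf.hasFDerivAt.rpow_const (Or.inl hx)).fderiv]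

lemma pd_coord (k : Fin 3) : pd j (fun y : E₃ => y k) x = if k = j then 1 else 0 := by
  have h : HasFDerivAt (fun y : E₃ => y k) (EuclideanSpace.proj k : E₃ →L[ℝ] ℝ) x :=
    (EuclideanSpace.proj k : E₃ →L[ℝ] ℝ).hasFDerivAt
  simp [pd, h.fderiv]

lemma ContDiff.pd {n : WithTop ℕ∞} (hf : ContDiff ℝ (n + 1) f) : ContDiff ℝ n (pd j f) :=
  (hf.fderiv_right le_rfl).clm_apply contDiff_const

lemma pd_comm (k : Fin 3) (hf : ContDiff ℝ 2 f) : pd j (pd k f) x = pd k (pd j f) x := by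
  have hd : DifferentiableAt ℝ (fderiv ℝ f) x :=
    (hf.fderiv_right (m := 1) (by norm_num)).differentiable one_ne_zero x
  have h : ∀ i l : Fin 3, pd i (pd l f) x =
      fderiv ℝ (fderiv ℝ f) x (EuclideanSpace.single i 1) (EuclideanSpace.single l 1) := by
    intro i l
    have := hd.hasFDerivAt.clm_apply
      (hasFDerivAt_const (EuclideanSpace.single l (1 : ℝ) : E₃) x)
    have h' := this.fderiv
    change fderiv ℝ (pd l f) x = _ at h'
    rw [pd, h']; simp
  rw [h, h]
  exact hf.contDiffAt.isSymmSndFDerivAt (by simp) _ _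

lemma pd_eq_gradient_apply (f : E₃ → ℝ) (x : E₃) : pd j f x = gradient f x j := by
  rw [pd, ← InnerProductSpace.toDual_symm_apply (𝕜 := ℝ), ← gradient,
    EuclideanSpace.inner_single_right]
  simp

lemma norm_gradient_sq (f : E₃ → ℝ) (x : E₃) :
    ‖gradient f x‖ ^ 2 = ∑ j, pd j f x ^ 2 := by
  simp [EuclideanSpace.norm_sq_eq, pd_eq_gradient_apply]

lemma abs_pd_le_norm_gradient (f : E₃ → ℝ) (x : E₃) : |pd j f x| ≤ ‖gradient f x‖ := by
  rw [pd_eq_gradient_apply]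
  exact PiLp.norm_apply_le (gradient f x) j

end PartialDerivatives

/-- Pohozaev identities for the ground state `Q` of
`−ΔQ + Q = Q^{α+1}` on ℝ³, and the resulting formulas for the free energy. -/
theorem pohozaev_identities
    (α : ℝ) (hα0 : 0 < α) (hα4 : α < 4)
    (Q : EuclideanSpace ℝ (Fin 3) → ℝ)
    (hQsmooth : ContDiff ℝ (⊤ : ℕ∞) Q)
    (hQpos : ∀ x, 0 < Q x)
    (heq : ∀ x, -(∑ j : Fin 3, pd j (pd j Q) x) + Q x = Q x ^ (α + 1))
    (C c : ℝ) (hC : 0 < C) (hc : 0 < c)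
    (hdecay : ∀ x, |Q x| + ‖gradient Q x‖ ≤ C * Real.exp (-c * ‖x‖)) :
    (∫ x, Q x ^ 2) = ((4 - α) / (3 * α)) * ∫ x, ‖gradient Q x‖ ^ 2 ∧
    (∫ x, Q x ^ 2) = ((4 - α) / (2 * (α + 2))) * ∫ x, Q x ^ (α + 2) ∧
    (1 / 2) * (∫ x, ‖gradient Q x‖ ^ 2) - (1 / (α + 2)) * (∫ x, Q x ^ (α + 2))
      = ((3 * α - 4) / (6 * α)) * ∫ x, ‖gradient Q x‖ ^ 2 ∧
    (1 / 2) * (∫ x, ‖gradient Q x‖ ^ 2) - (1 / (α + 2)) * (∫ x, Q x ^ (α + 2))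
      = ((3 * α - 4) / (4 * (α + 2))) * ∫ x, Q x ^ (α + 2) := by
  have hQ2 : ContDiff ℝ 2 Q := contDiff_infty.1 hQsmooth 2
  have hQ1 : ContDiff ℝ 1 Q := hQ2.of_le one_le_two
  have hg : ∀ j, ContDiff ℝ 1 (pd j Q) := fun j =>
    ContDiff.pd j (n := 1) (hQ2.of_le (by norm_num))
  have hQp : ContDiff ℝ 1 (fun x => Q x ^ (α + 2)) :=
    hQ1.rpow_const_of_ne fun x => (hQpos x).ne'
  have hexp : ∀ x : E₃, exp (-c * ‖x‖) ≤ 1 := fun x =>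
    Real.exp_le_one_iff.2 (by nlinarith [norm_nonneg x])
  have hQe : ∀ x, Q x ≤ C * exp (-c * ‖x‖) := fun x =>
    (le_abs_self _).trans (by linarith [hdecay x, norm_nonneg (gradient Q x)])
  have hge : ∀ j x, |pd j Q x| ≤ C * exp (-c * ‖x‖) := fun j x =>
    (abs_pd_le_norm_gradient j Q x).trans (by linarith [hdecay x, abs_nonneg (Q x)])
  have hsq : ∀ (a : ℝ) (x : E₃), |a| ≤ C * exp (-c * ‖x‖) →
      a ^ 2 ≤ C ^ 2 * exp (-c * ‖x‖) := fun a x ha => by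
    have h := pow_le_pow_left₀ (abs_nonneg a) ha 2
    rw [sq_abs, mul_pow] at h
    refine h.trans ?_
    gcongr
    exact pow_le_of_le_one (exp_pos _).le (hexp x) two_ne_zero
  have hgsq : ∀ j x, pd j Q x ^ 2 ≤ C ^ 2 * exp (-c * ‖x‖) := fun j x =>
    hsq _ x (hge j x)
  have hQsq : ∀ x, Q x ^ 2 ≤ C ^ 2 * exp (-c * ‖x‖) := fun x =>
    hsq _ x (by rw [abs_of_pos (hQpos x)]; exact hQe x)
  have hpow1 : ∀ x, Q x ^ (α + 2) = Q x * Q x ^ (α + 1) := fun x => by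
    rw [show α + 2 = (α + 1) + 1 by ring, Real.rpow_add_one (hQpos x).ne', mul_comm]
  have hQpe : ∀ x, Q x ^ (α + 2) ≤ C ^ α * C ^ 2 * exp (-c * ‖x‖) := fun x => by
    have h1 : Q x ^ (α + 2) = Q x ^ α * Q x ^ 2 := by
      rw [Real.rpow_add (hQpos x)]; norm_cast
    have h2 : Q x ^ α ≤ C ^ α := Real.rpow_le_rpow (hQpos x).le
      ((hQe x).trans (mul_le_of_le_one_right hC.le (hexp x))) hα0.le
    rw [h1, mul_assoc]
    exact mul_le_mul h2 (hQsq x) (by positivity) (by positivity)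
  have hCα : 0 ≤ C ^ α := by positivity
  have hdecay_int : ∀ {f : E₃ → ℝ} {K : ℝ}, 0 ≤ K → Continuous f →
      (∀ x, |f x| ≤ K * exp (-c * ‖x‖)) → Integrable f := by
    intro f K hK hf h
    refine hf.integrable_of_abs_le_one_add_norm_mul_exp hc hK fun x => (h x).trans ?_
    refine mul_le_mul_of_nonneg_left ?_ hK
    exact le_mul_of_one_le_left (exp_pos _).le (by linarith [norm_nonneg x])
  have hiB : Integrable (fun x => Q x ^ 2) :=
    hdecay_int (sq_nonneg C) (hQ1.continuous.pow 2) fun x => by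
      rw [abs_of_nonneg (sq_nonneg _)]; exact hQsq x
  have hig : ∀ j, Integrable (fun x => pd j Q x ^ 2) := fun j =>
    hdecay_int (sq_nonneg C) ((hg j).continuous.pow 2) fun x => by
      rw [abs_of_nonneg (sq_nonneg _)]; exact hgsq j x
  have hiA : Integrable (fun x => ‖gradient Q x‖ ^ 2) := by
    simp_rw [norm_gradient_sq]
    exact integrable_finsetSum _ fun j _ => hig j
  have hiP : Integrable (fun x => Q x ^ (α + 2)) :=
    hdecay_int (mul_nonneg hCα (sq_nonneg C)) hQp.continuous fun x => by
      rw [abs_of_nonneg (Real.rpow_nonneg (hQpos x).le _)]; exact hQpe x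
  have hdQ : ∀ x, DifferentiableAt ℝ Q x := fun x => hQ1.differentiable one_ne_zero x
  have hdg : ∀ j x, DifferentiableAt ℝ (pd j Q) x := fun j x =>
    (hg j).differentiable one_ne_zero x
  -- Testing the equation against `Q`.
  have hdiv₁ : ∀ x, ∑ j, pd j (fun y => Q y * pd j Q y) x =
      ‖gradient Q x‖ ^ 2 + Q x ^ 2 - Q x ^ (α + 2) := by
    intro x
    have h := heq x
    rw [norm_gradient_sq, hpow1, ← h]
    simp_rw [fun j => pd_mul j (hdQ x) (hdg j x)]
    simp only [Fin.sum_univ_three]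
    ring
  have hid₁ : (∫ x, ‖gradient Q x‖ ^ 2) + (∫ x, Q x ^ 2) - (∫ x, Q x ^ (α + 2)) = 0 := by
    have hiAB : Integrable (fun x => ‖gradient Q x‖ ^ 2 + Q x ^ 2) := hiA.add hiB
    rw [← integral_add hiA hiB, ← integral_sub hiAB hiP]
    rw [← integral_sum_pd_eq_zero (fun j y => Q y * pd j Q y) (fun j => hQ1.mul (hg j))]
    · simp_rw [hdiv₁]
    · intro j
      refine hdecay_int (sq_nonneg C) (hQ1.continuous.mul (hg j).continuous) fun x => ?_
      have h1 := hgsq j x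
      have h2 := hQsq x
      rw [abs_le]
      constructor <;> nlinarith [sq_nonneg (Q x - pd j Q x), sq_nonneg (Q x + pd j Q x)]
    · simp_rw [hdiv₁]
      exact (hiA.add hiB).sub hiP
  -- Testing the equation against `x · ∇Q`.
  let L : E₃ → ℝ := fun y => 1 / 2 * (pd 0 Q y ^ 2 + pd 1 Q y ^ 2 + pd 2 Q y ^ 2) +
    1 / 2 * Q y ^ 2 - (α + 2)⁻¹ * Q y ^ (α + 2)
  let X : E₃ → ℝ := fun y => y 0 * pd 0 Q y + y 1 * pd 1 Q y + y 2 * pd 2 Q y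
  have hcoord : ∀ k : Fin 3, ContDiff ℝ 1 (fun y : E₃ => y k) := fun k =>
    (EuclideanSpace.proj k : E₃ →L[ℝ] ℝ).contDiff
  have hdcoord : ∀ (k : Fin 3) (x : E₃), DifferentiableAt ℝ (fun y : E₃ => y k) x :=
    fun k x => (hcoord k).differentiable one_ne_zero x
  have hL : ContDiff ℝ 1 L :=
    ((contDiff_const.mul ((((hg 0).pow 2).add ((hg 1).pow 2)).add ((hg 2).pow 2))).add
      (contDiff_const.mul (hQ1.pow 2))).sub (contDiff_const.mul hQp)
  have hX : ContDiff ℝ 1 X :=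
    (((hcoord 0).mul (hg 0)).add ((hcoord 1).mul (hg 1))).add ((hcoord 2).mul (hg 2))
  have hpdL : ∀ j x, pd j L x = pd 0 Q x * pd j (pd 0 Q) x + pd 1 Q x * pd j (pd 1 Q) x +
      pd 2 Q x * pd j (pd 2 Q) x + Q x * pd j Q x - Q x ^ (α + 1) * pd j Q x := by
    intro j x
    have hs : ∀ k, DifferentiableAt ℝ (fun y => pd k Q y ^ 2) x := fun k => (hdg k x).pow 2
    have hp : DifferentiableAt ℝ (fun y => Q y ^ (α + 2)) x :=
      hQp.differentiable one_ne_zero x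
    have hq : DifferentiableAt ℝ (fun y => Q y ^ 2) x := (hdQ x).pow 2
    have hs₂ : DifferentiableAt ℝ (fun y => pd 0 Q y ^ 2 + pd 1 Q y ^ 2) x :=
      (hs 0).add (hs 1)
    have hs₃ : DifferentiableAt ℝ
        (fun y => pd 0 Q y ^ 2 + pd 1 Q y ^ 2 + pd 2 Q y ^ 2) x := hs₂.add (hs 2)
    have hsq : DifferentiableAt ℝ (fun y => 1 / 2 * (pd 0 Q y ^ 2 + pd 1 Q y ^ 2 +
        pd 2 Q y ^ 2) + 1 / 2 * Q y ^ 2) x := (hs₃.const_mul _).add (hq.const_mul _)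
    rw [pd_sub j hsq (hp.const_mul _), pd_add j (hs₃.const_mul _) (hq.const_mul _),
      pd_const_mul j _ hs₃, pd_const_mul j _ hq, pd_const_mul j _ hp, pd_add j hs₂ (hs 2),
      pd_add j (hs 0) (hs 1), pd_sq j (hdg 0 x), pd_sq j (hdg 1 x), pd_sq j (hdg 2 x),
      pd_sq j (hdQ x), pd_rpow_const j _ (hdQ x) (hQpos x).ne',
      show α + 2 - 1 = α + 1 by ring]
    have : α + 2 ≠ 0 := by positivity
    field_simp
  have hpdX : ∀ j x, pd j X x = x 0 * pd j (pd 0 Q) x + x 1 * pd j (pd 1 Q) x +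
      x 2 * pd j (pd 2 Q) x + pd j Q x := by
    intro j x
    have hm : ∀ k, DifferentiableAt ℝ (fun y : E₃ => y k * pd k Q y) x := fun k =>
      (hdcoord k x).mul (hdg k x)
    have hm₂ : DifferentiableAt ℝ (fun y : E₃ => y 0 * pd 0 Q y + y 1 * pd 1 Q y) x :=
      (hm 0).add (hm 1)
    rw [pd_add j hm₂ (hm 2), pd_add j (hm 0) (hm 1),
      pd_mul j (hdcoord 0 x) (hdg 0 x), pd_mul j (hdcoord 1 x) (hdg 1 x),
      pd_mul j (hdcoord 2 x) (hdg 2 x)]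
    simp only [pd_coord]
    fin_cases j <;> simp <;> ring
  have hdiv₂ : ∀ x, ∑ j, pd j (fun y => X y * pd j Q y - y j * L y) x =
      -(1 / 2) * ‖gradient Q x‖ ^ 2 - 3 / 2 * Q x ^ 2 + 3 * (α + 2)⁻¹ * Q x ^ (α + 2) := by
    intro x
    have hXd : DifferentiableAt ℝ X x := hX.differentiable one_ne_zero x
    have hLd : DifferentiableAt ℝ L x := hL.differentiable one_ne_zero x
    have h := heq x
    have hj : ∀ j, pd j (fun y => X y * pd j Q y - y j * L y) x =
        X x * pd j (pd j Q) x + pd j X x * pd j Q x - (x j * pd j L x + L x) := fun j => by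
      have h1 : DifferentiableAt ℝ (fun y => X y * pd j Q y) x := hXd.mul (hdg j x)
      have h2 : DifferentiableAt ℝ (fun y => y j * L y) x := (hdcoord j x).mul hLd
      rw [pd_sub j h1 h2, pd_mul j hXd (hdg j x), pd_mul j (hdcoord j x) hLd, pd_coord]
      simp
    simp_rw [hj, hpdL, hpdX]
    rw [norm_gradient_sq]
    simp only [Fin.sum_univ_three] at h ⊢
    rw [pd_comm 1 0 hQ2, pd_comm 2 0 hQ2, pd_comm 2 1 hQ2]
    simp only [L, X]
    linear_combination -(x 0 * pd 0 Q x + x 1 * pd 1 Q x + x 2 * pd 2 Q x) * h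
  have hLe : ∀ x, |L x| ≤ (2 * C ^ 2 + C ^ α * C ^ 2) * exp (-c * ‖x‖) := by
    intro x
    have hinv : (α + 2)⁻¹ ≤ 1 := inv_le_one_of_one_le₀ (by linarith)
    have hp0 : 0 ≤ Q x ^ (α + 2) := Real.rpow_nonneg (hQpos x).le _
    have hp1 : (α + 2)⁻¹ * Q x ^ (α + 2) ≤ Q x ^ (α + 2) := mul_le_of_le_one_left hp0 hinv
    have hp2 : 0 ≤ (α + 2)⁻¹ * Q x ^ (α + 2) := by positivity
    have he : 0 ≤ C ^ 2 * exp (-c * ‖x‖) := by positivity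
    have he' : 0 ≤ C ^ α * C ^ 2 * exp (-c * ‖x‖) := by positivity
    rw [abs_le]
    constructor <;> simp only [L] <;>
      linarith [hgsq 0 x, hgsq 1 x, hgsq 2 x, hQsq x, hQpe x, sq_nonneg (pd 0 Q x),
        sq_nonneg (pd 1 Q x), sq_nonneg (pd 2 Q x), sq_nonneg (Q x)]
  have hid₂ : -(1 / 2) * (∫ x, ‖gradient Q x‖ ^ 2) - 3 / 2 * (∫ x, Q x ^ 2) +
      3 * (α + 2)⁻¹ * (∫ x, Q x ^ (α + 2)) = 0 := by
    have hiAB : Integrable (fun x => -(1 / 2) * ‖gradient Q x‖ ^ 2 - 3 / 2 * Q x ^ 2) :=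
      (hiA.const_mul _).sub (hiB.const_mul _)
    rw [← integral_const_mul, ← integral_const_mul, ← integral_const_mul,
      ← integral_sub (hiA.const_mul _) (hiB.const_mul _),
      ← integral_add hiAB (hiP.const_mul _)]
    rw [← integral_sum_pd_eq_zero (fun j y => X y * pd j Q y - y j * L y)
      (fun j => (hX.mul (hg j)).sub ((hcoord j).mul hL))]
    · simp_rw [hdiv₂]
    · intro j
      refine ((hX.mul (hg j)).sub
        ((hcoord j).mul hL)).continuous.integrable_of_abs_le_one_add_norm_mul_exp
        (K := 5 * C ^ 2 + C ^ α * C ^ 2) hc (by positivity) fun x => ?_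
      have hx : ∀ k, |x k| ≤ ‖x‖ := fun k => PiLp.norm_apply_le x k
      have hterm : ∀ k, |x k * pd k Q x| ≤ ‖x‖ * C := fun k => by
        rw [abs_mul]
        exact mul_le_mul (hx k) ((hge k x).trans (mul_le_of_le_one_right hC.le (hexp x)))
          (abs_nonneg _) (norm_nonneg _)
      have hX' : |X x| ≤ 3 * (‖x‖ * C) := by
        refine (abs_add_three _ _ _).trans ?_
        linarith [hterm 0, hterm 1, hterm 2]
      calc |X x * pd j Q x - x j * L x| ≤ |X x| * |pd j Q x| + |x j| * |L x| := by
            rw [← abs_mul, ← abs_mul]; exact abs_sub _ _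
        _ ≤ 3 * (‖x‖ * C) * (C * exp (-c * ‖x‖)) +
            ‖x‖ * ((2 * C ^ 2 + C ^ α * C ^ 2) * exp (-c * ‖x‖)) :=
          add_le_add (mul_le_mul hX' (hge j x) (abs_nonneg _) (by positivity))
            (mul_le_mul (hx j) (hLe x) (abs_nonneg _) (norm_nonneg _))
        _ = (5 * C ^ 2 + C ^ α * C ^ 2) * (‖x‖ * exp (-c * ‖x‖)) := by ring
        _ ≤ _ := by gcongr; linarith
    · simp_rw [hdiv₂]
      exact hiAB.add (hiP.const_mul _)
  generalize (∫ x, ‖gradient Q x‖ ^ 2) = A at *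
  generalize (∫ x, Q x ^ 2) = B at *
  generalize (∫ x, Q x ^ (α + 2)) = P at *
  have hα2 : α + 2 ≠ 0 := by positivity
  have hP : P = A + B := by linarith
  have hBA : B = (4 - α) / (3 * α) * A := by
    rw [hP] at hid₂
    field_simp at hid₂ ⊢
    linarith
  subst hP
  rw [hBA]
  refine ⟨rfl, ?_, ?_, ?_⟩ <;> field_simp <;> ring
end
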